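/- For any p ∈ ℕ₀ and q ∈ ℕ, the differentiation operator W : C^∞_N → C^∞_N extends to a continuous linear operator B^{p,q}_N → B^{p,q+1}_N; indeed ‖Wh‖_{p,q+1} ≤ (2πK|N|p + 1)·‖h‖_{p,q} for all h ∈ C^∞_N. -/

import Mathlib

open MeasureTheory Filter Asymptotics

noncomputable section

/-- The Heisenberg group `ℍ`: `ℝ³` with the polarised group law
`(x,y,z) * (x',y',z') = (x+x', y+y', z+z'+x·y')`. -/
abbrev Heis : Type := ℝ × ℝ × ℝ

/-- The group law of the Heisenberg group. -/
def hmul (g g' : Heis) : Heis :=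
  (g.1 + g'.1, g.2.1 + g'.2.1, g.2.2 + g'.2.2 + g.1 * g'.2.1)

/-- The Lie bracket on the Lie algebra `ℝ³` of the Heisenberg group. -/
def hbracket (v w : ℝ × ℝ × ℝ) : ℝ × ℝ × ℝ :=
  (0, 0, v.1 * w.2.1 - w.1 * v.2.1)

/-- The exponential map of the Heisenberg group. -/
def hexp (v : ℝ × ℝ × ℝ) : Heis := (v.1, v.2.1, v.2.2 + v.1 * v.2.1 / 2)

/-- The inverse of the exponential map. -/
def hlog (g : Heis) : ℝ × ℝ × ℝ := (g.1, g.2.1, g.2.2 - g.1 * g.2.1 / 2)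

/-- The basis element `X` of the Lie algebra. -/
def Xvec : ℝ × ℝ × ℝ := (1, 0, 0)

/-- The basis element `Y` of the Lie algebra. -/
def Yvec : ℝ × ℝ × ℝ := (0, 1, 0)

/-- The central element `Z` of the Lie algebra. -/
def Zvec : ℝ × ℝ × ℝ := (0, 0, 1)

/-- The lattice `Γ_K = {(x, y, z/K) : x,y,z ∈ ℤ}`. -/
def GammaK (K : ℕ) : Set Heis :=
  {g | ∃ x y z : ℤ, g = ((x : ℝ), (y : ℝ), (z : ℝ) / K)}

/-- The flow generated by the left-invariant vector field associated to `U`: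
`m ↦ m * exp (t U)`. -/
def hflow (U : ℝ × ℝ × ℝ) (t : ℝ) (m : Heis) : Heis := hmul m (hexp (t • U))

/-- The action of the left-invariant vector field associated to `U` on functions. -/
def VF (U : ℝ × ℝ × ℝ) (h : Heis → ℂ) (m : Heis) : ℂ :=
  deriv (fun t : ℝ => h (hflow U t m)) 0

/-- `C^∞(M)`: smooth `Γ_K`-invariant functions on `ℍ` (functions on `M = Γ_K\ℍ`). -/
def SmoothM (K : ℕ) (h : Heis → ℂ) : Prop :=
  ContDiff ℝ (⊤ : ℕ∞) h ∧ ∀ γ ∈ GammaK K, ∀ m : Heis, h (hmul γ m) = h m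

/-- `C^q(M)`: `C^q` `Γ_K`-invariant functions on `ℍ`. -/
def CqM (K : ℕ) (q : ℕ) (g : Heis → ℂ) : Prop :=
  ContDiff ℝ q g ∧ ∀ γ ∈ GammaK K, ∀ m : Heis, g (hmul γ m) = g m

/-- `C^∞_N = {h ∈ C^∞(M) : Z h = 2πiNK·h}`. -/
def CN (K : ℕ) (N : ℤ) (h : Heis → ℂ) : Prop :=
  SmoothM K h ∧ VF Zvec h = fun m => (2 * Real.pi * Complex.I * N * K) * h m

/-- The `C^r` norm `‖f‖_{C^r} = sup_{k ≤ r} 2^{r-k} sup |f^{(k)}|` of a function on `ℝ`. -/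
def CrNorm (r : ℕ) (η : ℝ → ℂ) : ℝ :=
  ⨆ k : Fin (r + 1), (2 : ℝ) ^ (r - (k : ℕ)) * ⨆ t : ℝ, ‖iteratedDeriv (k : ℕ) η t‖

/-- The `C^r` norm of a function on `M`. -/
def MCrNorm (r : ℕ) (g : Heis → ℂ) : ℝ :=
  ⨆ k : Fin (r + 1), (2 : ℝ) ^ (r - (k : ℕ)) * ⨆ m : Heis, ‖iteratedFDeriv ℝ (k : ℕ) g m‖

/-- Test functions: `C^∞` functions with support compactly contained in `(-δ, δ)`. -/
def TestFun (δ : ℝ) (η : ℝ → ℂ) : Prop :=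
  ContDiff ℝ (⊤ : ℕ∞) η ∧ HasCompactSupport η ∧ tsupport η ⊆ Set.Ioo (-δ) δ

/-- The linear functional `ℓ_{η,m}(h) = ∫_{-δ}^{δ} η(t)·h(φ_t^W(m)) dt`. -/
def ell (Wd : ℝ × ℝ × ℝ) (δ : ℝ) (η : ℝ → ℂ) (m : Heis) (h : Heis → ℂ) : ℂ :=
  ∫ t in (-δ)..δ, η t * h (hflow Wd t m)

/-- The seminorm `|h|_{j,q}`. -/
def semiNorm (Vd Wd : ℝ × ℝ × ℝ) (δ : ℝ) (j q : ℕ) (h : Heis → ℂ) : ℝ :=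
  sSup {x : ℝ | ∃ m : Heis, ∃ η : ℝ → ℂ, TestFun δ η ∧ CrNorm q η ≤ 1 ∧
    x = ‖ell Wd δ η m ((VF Vd)^[j] h)‖}

/-- The anisotropic norm `‖h‖_{p,q}`. -/
def pqNorm (Vd Wd : ℝ × ℝ × ℝ) (δ : ℝ) (p q : ℕ) (h : Heis → ℂ) : ℝ :=
  sSup {x : ℝ | ∃ j : ℕ, j ≤ p ∧ ∃ m : Heis, ∃ η : ℝ → ℂ, TestFun δ η ∧ CrNorm q η ≤ 1 ∧
    x = ‖ell Wd δ η m ((VF Vd)^[j] h)‖}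

/-- Integration over `M = Γ_K\ℍ` with respect to the probability measure `ν`
inherited from the Haar measure, computed on the fundamental domain
`[0,1) × [0,1) × [0,1/K)` (rescaled by `K` to have total mass one). -/
def nuInt (K : ℕ) (f : Heis → ℂ) : ℂ :=
  (K : ℂ) * (∫ m in (Set.Icc (0 : ℝ) 1 ×ˢ (Set.Icc (0 : ℝ) 1 ×ˢ Set.Icc (0 : ℝ) (1 / K))), f m)

/-- The setting of the paper: a Heisenberg nilmanifold `M = Γ_K\ℍ`, a partially
hyperbolic automorphism `Φ` with `Φ_* V = λ⁻¹ V`, `Φ_* W = λ W`, `Φ_* Z = Z` for a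
Heisenberg frame `{V, W, Z}`, and a fixed small `δ > 0`. -/
structure NilSetting where
  K : ℕ
  hK : 0 < K
  lam : ℝ
  hlam : 1 < lam
  Vd : ℝ × ℝ × ℝ
  Wd : ℝ × ℝ × ℝ
  frame : hbracket Vd Wd = Zvec
  Φ : Heis → Heis
  Φbij : Function.Bijective Φ
  Φhom : ∀ g g' : Heis, Φ (hmul g g') = hmul (Φ g) (Φ g')
  Φlattice : Φ '' GammaK K = GammaK K
  ΦV : ∀ t : ℝ, Φ (hexp (t • Vd)) = hexp ((lam⁻¹ * t) • Vd)
  ΦW : ∀ t : ℝ, Φ (hexp (t • Wd)) = hexp ((lam * t) • Wd)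
  ΦZ : ∀ t : ℝ, Φ (hexp (t • Zvec)) = hexp (t • Zvec)
  δ : ℝ
  hδ : 0 < δ

namespace NilSetting

/-- The transfer operator `L : h ↦ h ∘ Φ`. -/
def L (S : NilSetting) (h : Heis → ℂ) : Heis → ℂ := fun m => h (S.Φ m)

/-- The space `C^∞_N` as a set of functions. -/
def cn (S : NilSetting) (N : ℤ) : Set (Heis → ℂ) := {h | CN S.K N h}

/-- The anisotropic norm `‖·‖_{p,q}` of the setting. -/
def nrm (S : NilSetting) (p q : ℕ) (h : Heis → ℂ) : ℝ := pqNorm S.Vd S.Wd S.δ p q h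

/-- The seminorm `|·|_{j,q}` of the setting. -/
def snrm (S : NilSetting) (j q : ℕ) (h : Heis → ℂ) : ℝ := semiNorm S.Vd S.Wd S.δ j q h

end NilSetting

/-- `(B, j)` is a realisation of the completion of `Sset` with respect to the
norm `Nrm`: `j` is linear and isometric on `Sset` and has dense image. -/
def IsCompletion (Nrm : (Heis → ℂ) → ℝ) (Sset : Set (Heis → ℂ))
    {B : Type} [NormedAddCommGroup B] [NormedSpace ℂ B] (j : (Heis → ℂ) → B) : Prop :=
  CompleteSpace B ∧
  (∀ h ∈ Sset, ∀ h' ∈ Sset, j (h + h') = j h + j h') ∧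
  (∀ (c : ℂ), ∀ h ∈ Sset, j (c • h) = c • j h) ∧
  (∀ h ∈ Sset, ‖j h‖ = Nrm h) ∧
  Dense (j '' Sset)

/-- The left-invariant vector field associated to `U`, in coordinates. -/
def leftField (U : ℝ × ℝ × ℝ) (m : Heis) : ℝ × ℝ × ℝ :=
  (U.1, U.2.1, U.2.2 + m.1 * U.2.1)

lemma hflow_zero (U : ℝ × ℝ × ℝ) (m : Heis) : hflow U 0 m = m := by
  simp [hflow, hexp, hmul]

lemma hflow_add (U : ℝ × ℝ × ℝ) (s t : ℝ) (m : Heis) :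
    hflow U (s + t) m = hflow U t (hflow U s m) := by
  simp only [hflow, hexp, hmul, Prod.smul_fst, Prod.smul_snd, smul_eq_mul, Prod.mk.injEq]
  refine ⟨by ring, by ring, by ring⟩

lemma hflow_hmul (U : ℝ × ℝ × ℝ) (t : ℝ) (γ m : Heis) :
    hflow U t (hmul γ m) = hmul γ (hflow U t m) := by
  simp only [hflow, hmul, Prod.mk.injEq]
  refine ⟨by ring, by ring, by ring⟩

lemma contDiff_hflow (U : ℝ × ℝ × ℝ) (m : Heis) :
    ContDiff ℝ (⊤ : ℕ∞) (fun t : ℝ => hflow U t m) := by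
  unfold hflow hexp hmul
  simp only [Prod.smul_fst, Prod.smul_snd, smul_eq_mul]
  fun_prop

lemma hasDerivAt_hflow_zero (U : ℝ × ℝ × ℝ) (m : Heis) :
    HasDerivAt (fun t : ℝ => hflow U t m) (leftField U m) 0 := by
  unfold hflow hexp hmul leftField
  simp only [Prod.smul_fst, Prod.smul_snd, smul_eq_mul]
  have hid := hasDerivAt_id (0 : ℝ)
  refine HasDerivAt.prodMk ?_ (HasDerivAt.prodMk ?_ ?_)
  · simpa using (hid.mul_const U.1).const_add m.1
  · simpa using (hid.mul_const U.2.1).const_add m.2.1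
  · have h := (((hid.mul_const U.2.2).add
      (((hid.mul_const U.1).mul (hid.mul_const U.2.1)).div_const 2)).const_add m.2.2).add
      ((hid.mul_const U.2.1).const_mul m.1)
    simpa [Pi.add_def] using! h

lemma VF_apply {h : Heis → ℂ} (hh : ContDiff ℝ (⊤ : ℕ∞) h) (U : ℝ × ℝ × ℝ) (m : Heis) :
    VF U h m = fderiv ℝ h m (leftField U m) := by
  have h1 : HasFDerivAt h (fderiv ℝ h m) (hflow U 0 m) := by
    rw [hflow_zero]
    exact (hh.differentiable (by simp) m).hasFDerivAt
  exact (h1.comp_hasDerivAt 0 (hasDerivAt_hflow_zero U m)).deriv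

lemma contDiff_leftField (U : ℝ × ℝ × ℝ) : ContDiff ℝ (⊤ : ℕ∞) (leftField U) := by
  unfold leftField
  fun_prop

lemma contDiff_VF {h : Heis → ℂ} (hh : ContDiff ℝ (⊤ : ℕ∞) h) (U : ℝ × ℝ × ℝ) :
    ContDiff ℝ (⊤ : ℕ∞) (VF U h) := by
  have : VF U h = fun m => fderiv ℝ h m (leftField U m) := funext (VF_apply hh U)
  rw [this]
  exact (hh.fderiv_right (by simp)).clm_apply (contDiff_leftField U)

lemma hasDerivAt_comp_hflow {h : Heis → ℂ} (hh : ContDiff ℝ (⊤ : ℕ∞) h) (U : ℝ × ℝ × ℝ)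
    (m : Heis) (t : ℝ) :
    HasDerivAt (fun s : ℝ => h (hflow U s m)) (VF U h (hflow U t m)) t := by
  have hd : DifferentiableAt ℝ (fun s : ℝ => h (hflow U s m)) t :=
    (hh.comp (contDiff_hflow U m)).differentiable (by simp) t
  have hval : VF U h (hflow U t m) = deriv (fun s : ℝ => h (hflow U s m)) t := by
    unfold VF
    simp_rw [← hflow_add]
    rw [deriv_comp_const_add (f := fun s : ℝ => h (hflow U s m)), add_zero]
  rw [hval]
  exact hd.hasDerivAt

lemma VF_add {h h' : Heis → ℂ} (hh : ContDiff ℝ (⊤ : ℕ∞) h) (hh' : ContDiff ℝ (⊤ : ℕ∞) h')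
    (U : ℝ × ℝ × ℝ) : VF U (h + h') = VF U h + VF U h' := by
  ext m
  have hd := hh.differentiable (by simp) m
  have hd' := hh'.differentiable (by simp) m
  rw [Pi.add_apply, VF_apply (h := h + h') (hh.add hh'), VF_apply hh, VF_apply hh', fderiv_add hd hd']
  rfl

lemma VF_smul {h : Heis → ℂ} (hh : ContDiff ℝ (⊤ : ℕ∞) h) (c : ℂ) (U : ℝ × ℝ × ℝ) :
    VF U (c • h) = c • VF U h := by
  ext m
  have hd := hh.differentiable (by simp) m
  rw [Pi.smul_apply, VF_apply (h := c • h) (hh.const_smul c), VF_apply hh, fderiv_const_smul hd]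
  rfl

/-- The left-invariant vector fields realise the Lie bracket. -/
lemma VF_comm {h : Heis → ℂ} (hh : ContDiff ℝ (⊤ : ℕ∞) h) (A B : ℝ × ℝ × ℝ) :
    VF A (VF B h) = VF B (VF A h) + VF (hbracket A B) h := by
  have key : ∀ (A B : ℝ × ℝ × ℝ) (m : Heis), VF A (VF B h) m =
      fderiv ℝ (fderiv ℝ h) m (leftField A m) (leftField B m) +
        fderiv ℝ h m (0, 0, A.1 * B.2.1) := by
    intro A B m
    have hfun : VF B h = fun m => fderiv ℝ h m (leftField B m) := funext (VF_apply hh B)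
    have hL : HasFDerivAt (leftField B)
        ((0 : Heis →L[ℝ] ℝ).prod ((0 : Heis →L[ℝ] ℝ).prod
          (B.2.1 • ContinuousLinearMap.fst ℝ ℝ (ℝ × ℝ)))) m := by
      unfold leftField
      exact (hasFDerivAt_const _ _).prodMk ((hasFDerivAt_const _ _).prodMk
        (((ContinuousLinearMap.fst ℝ ℝ (ℝ × ℝ)).hasFDerivAt.mul_const B.2.1).const_add _))
    have hF : DifferentiableAt ℝ (fderiv ℝ h) m :=
      (hh.fderiv_right (m := (⊤ : ℕ∞)) (by simp)).differentiable (by simp) m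
    rw [VF_apply (contDiff_VF hh B), hfun, (hF.hasFDerivAt.clm_apply hL).fderiv]
    simp [leftField, mul_comm, add_comm]
  have hsymm : ∀ m, IsSymmSndFDerivAt ℝ h m := fun m =>
    (contDiff_infty.1 hh 2).contDiffAt.isSymmSndFDerivAt (by simp)
  ext m
  rw [Pi.add_apply, key, key, VF_apply hh, (hsymm m).eq, add_assoc, ← map_add]
  congr 2
  simp [leftField, hbracket]

lemma CN.contDiff {K : ℕ} {N : ℤ} {h : Heis → ℂ} (hh : CN K N h) :
    ContDiff ℝ (⊤ : ℕ∞) h := hh.1.1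

lemma CN.add {K : ℕ} {N : ℤ} {h h' : Heis → ℂ} (hh : CN K N h) (hh' : CN K N h') :
    CN K N (h + h') := by
  refine ⟨⟨hh.contDiff.add hh'.contDiff, fun γ hγ m => ?_⟩, ?_⟩
  · simp only [Pi.add_apply, hh.1.2 γ hγ m, hh'.1.2 γ hγ m]
  · rw [VF_add hh.contDiff hh'.contDiff, hh.2, hh'.2]
    ext m
    simp only [Pi.add_apply, mul_add]

lemma CN.smul {K : ℕ} {N : ℤ} {h : Heis → ℂ} (hh : CN K N h) (c : ℂ) : CN K N (c • h) := by
  refine ⟨⟨hh.contDiff.const_smul c, fun γ hγ m => ?_⟩, ?_⟩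
  · simp only [Pi.smul_apply, hh.1.2 γ hγ m]
  · rw [VF_smul hh.contDiff, hh.2]
    ext m
    simp only [Pi.smul_apply, smul_eq_mul]
    ring

lemma CN.zero (K : ℕ) (N : ℤ) : CN K N 0 := by
  refine ⟨⟨contDiff_const, fun γ hγ m => rfl⟩, ?_⟩
  ext m
  simp [VF]

lemma CN.VF_Zvec {K : ℕ} {N : ℤ} {h : Heis → ℂ} (hh : CN K N h) :
    VF Zvec h = (2 * Real.pi * Complex.I * N * K : ℂ) • h := hh.2

lemma VF_zero_vec (h : Heis → ℂ) : VF 0 h = 0 := by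
  ext m
  simp [VF, hflow]

lemma CN.VF {K : ℕ} {N : ℤ} {h : Heis → ℂ} (hh : CN K N h) (U : ℝ × ℝ × ℝ) :
    CN K N (VF U h) := by
  refine ⟨⟨contDiff_VF hh.contDiff U, fun γ hγ m => ?_⟩, ?_⟩
  · simp only [_root_.VF, hflow_hmul, hh.1.2 γ hγ]
  · have h0 : hbracket Zvec U = 0 := by simp [hbracket, Zvec]
    rw [VF_comm hh.contDiff, h0, VF_zero_vec, add_zero, hh.VF_Zvec, VF_smul hh.contDiff]
    rfl

lemma CN.iterate_VF {K : ℕ} {N : ℤ} {h : Heis → ℂ} (hh : CN K N h) (U : ℝ × ℝ × ℝ) (j : ℕ) :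
    CN K N ((_root_.VF U)^[j] h) := by
  induction j with
  | zero => exact hh
  | succ j ih => rw [Function.iterate_succ_apply']; exact ih.VF U

lemma CN.iterate_VF_comm {K : ℕ} {N : ℤ} {h : Heis → ℂ} (hh : CN K N h) {V W : ℝ × ℝ × ℝ}
    (hVW : hbracket V W = Zvec) (j : ℕ) :
    (_root_.VF V)^[j] (_root_.VF W h) = _root_.VF W ((_root_.VF V)^[j] h) +
      ((j : ℂ) * (2 * Real.pi * Complex.I * N * K)) • (_root_.VF V)^[j - 1] h := by
  induction j with
  | zero => simp
  | succ j ih =>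
    have hj := hh.iterate_VF V j
    have hj' := hh.iterate_VF V (j - 1)
    rw [Function.iterate_succ_apply', ih, VF_add (hj.VF W).contDiff (hj'.smul _).contDiff,
      VF_smul hj'.contDiff, VF_comm hj.contDiff, hVW, hj.VF_Zvec,
      Function.iterate_succ_apply' (_root_.VF V) j h, add_assoc]
    congr 1
    rw [Nat.add_sub_cancel]
    rcases j with _ | j
    · simp
    · rw [Nat.add_sub_cancel, ← Function.iterate_succ_apply' (_root_.VF V) j h, ← add_smul]
      congr 1
      push_cast
      ring

/-- A continuous function on the compact nilmanifold is bounded. -/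
lemma SmoothM.exists_bound {K : ℕ} (hK : 0 < K) {h : Heis → ℂ} (hh : SmoothM K h) :
    ∃ C, 0 ≤ C ∧ ∀ m, ‖h m‖ ≤ C := by
  have hc : IsCompact (Set.Icc (0 : ℝ) 1 ×ˢ (Set.Icc (0 : ℝ) 1 ×ˢ Set.Icc (0 : ℝ) 1)) :=
    isCompact_Icc.prod (isCompact_Icc.prod isCompact_Icc)
  obtain ⟨C, hC⟩ := hc.exists_bound_of_continuousOn hh.1.continuous.continuousOn
  refine ⟨max C 0, le_max_right _ _, fun m => le_max_of_le_left ?_⟩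
  have hK1 : (1 : ℝ) ≤ K := by exact_mod_cast hK
  have hK0 : (0 : ℝ) < K := by linarith
  set w : ℝ := m.2.2 + (-⌊m.1⌋ : ℤ) * m.2.1 with hw
  let γ : Heis := (((-⌊m.1⌋ : ℤ) : ℝ), ((-⌊m.2.1⌋ : ℤ) : ℝ), ((-⌊K * w⌋ : ℤ) : ℝ) / K)
  have hγ : γ ∈ GammaK K := ⟨_, _, _, rfl⟩
  have hz : hmul γ m = (Int.fract m.1, Int.fract m.2.1, Int.fract (K * w) / K) := by
    simp only [hmul, γ, Prod.mk.injEq, Int.fract]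
    refine ⟨by push_cast; ring, by push_cast; ring, ?_⟩
    rw [sub_div, mul_div_cancel_left₀ _ hK0.ne', hw]
    push_cast
    ring
  rw [← hh.2 γ hγ m, hz]
  refine hC _ ⟨⟨Int.fract_nonneg _, (Int.fract_lt_one _).le⟩,
    ⟨Int.fract_nonneg _, (Int.fract_lt_one _).le⟩,
    div_nonneg (Int.fract_nonneg _) hK0.le, ?_⟩
  exact (div_le_one hK0).2 ((Int.fract_lt_one _).le.trans hK1)

lemma TestFun.deriv {δ : ℝ} {η : ℝ → ℂ} (hη : TestFun δ η) : TestFun δ (deriv η) :=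
  ⟨(contDiff_infty_iff_deriv.1 hη.1).2, hη.2.1.deriv, tsupport_deriv_subset.trans hη.2.2⟩

lemma TestFun.eq_zero {δ : ℝ} {η : ℝ → ℂ} (hη : TestFun δ η) {t : ℝ}
    (ht : t ∉ Set.Ioo (-δ) δ) : η t = 0 :=
  image_eq_zero_of_notMem_tsupport fun h => ht (hη.2.2 h)

lemma mul_iSup_iteratedDeriv_le_crNorm {r k : ℕ} (hk : k ≤ r) (η : ℝ → ℂ) :
    (2 : ℝ) ^ (r - k) * ⨆ t : ℝ, ‖iteratedDeriv k η t‖ ≤ CrNorm r η :=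
  le_ciSup (f := fun k : Fin (r + 1) =>
    (2 : ℝ) ^ (r - (k : ℕ)) * ⨆ t : ℝ, ‖iteratedDeriv (k : ℕ) η t‖)
    (Set.finite_range _).bddAbove ⟨k, Nat.lt_succ_of_le hk⟩

lemma crNorm_deriv_le (r : ℕ) (η : ℝ → ℂ) : CrNorm r (deriv η) ≤ CrNorm (r + 1) η := by
  refine ciSup_le fun k => ?_
  have h := mul_iSup_iteratedDeriv_le_crNorm (r := r + 1) (k := k + 1) (by omega) η
  rwa [Nat.add_sub_add_right, iteratedDeriv_succ'] at h

lemma crNorm_le_succ (r : ℕ) (η : ℝ → ℂ) : CrNorm r η ≤ CrNorm (r + 1) η := by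
  refine ciSup_le fun k => le_trans ?_
    (mul_iSup_iteratedDeriv_le_crNorm (r := r + 1) (k := k) (by omega) η)
  exact mul_le_mul_of_nonneg_right (pow_le_pow_right₀ one_le_two (by omega))
    (Real.iSup_nonneg fun _ => norm_nonneg _)

lemma TestFun.norm_le_crNorm {δ : ℝ} {η : ℝ → ℂ} (hη : TestFun δ η) (r : ℕ) (t : ℝ) :
    ‖η t‖ ≤ CrNorm r η := by
  obtain ⟨C, hC⟩ := hη.2.1.exists_bound_of_continuous hη.1.continuous
  have hb : BddAbove (Set.range fun t => ‖iteratedDeriv 0 η t‖) := by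
    refine ⟨C, ?_⟩
    rintro _ ⟨t, rfl⟩
    simpa using hC t
  have h1 : ‖η t‖ ≤ ⨆ t : ℝ, ‖iteratedDeriv 0 η t‖ := by simpa using le_ciSup hb t
  refine h1.trans (le_trans ?_ (mul_iSup_iteratedDeriv_le_crNorm (Nat.zero_le r) η))
  exact le_mul_of_one_le_left (Real.iSup_nonneg fun _ => norm_nonneg _)
    (one_le_pow₀ one_le_two)

lemma TestFun.continuous_mul_comp_hflow {δ : ℝ} {η : ℝ → ℂ} (hη : TestFun δ η)
    {h : Heis → ℂ} (hh : Continuous h) (U : ℝ × ℝ × ℝ) (m : Heis) :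
    Continuous fun t : ℝ => η t * h (hflow U t m) :=
  hη.1.continuous.mul (hh.comp (contDiff_hflow U m).continuous)

lemma norm_ell_le {δ : ℝ} (hδ : 0 < δ) {q : ℕ} {η : ℝ → ℂ} (hη : TestFun δ η)
    (hη1 : CrNorm q η ≤ 1) (U : ℝ × ℝ × ℝ) (m : Heis) {h : Heis → ℂ} {C : ℝ}
    (hC : ∀ m, ‖h m‖ ≤ C) : ‖ell U δ η m h‖ ≤ C * (2 * δ) := by
  have h1 := intervalIntegral.norm_integral_le_of_norm_le_const (a := -δ) (b := δ) (C := C)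
    (f := fun t : ℝ => η t * h (hflow U t m)) fun t _ => by
      rw [norm_mul]
      calc ‖η t‖ * ‖h (hflow U t m)‖ ≤ 1 * C :=
            mul_le_mul ((hη.norm_le_crNorm q t).trans hη1) (hC _) (norm_nonneg _) zero_le_one
        _ = C := one_mul C
  have h2 : |δ - -δ| = 2 * δ := by rw [abs_of_nonneg] <;> linarith
  rwa [h2] at h1

lemma ell_add_smul {δ : ℝ} {η : ℝ → ℂ} (hη : TestFun δ η) (U : ℝ × ℝ × ℝ) (m : Heis)
    {h h' : Heis → ℂ} (hh : Continuous h) (hh' : Continuous h') (c : ℂ) :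
    ell U δ η m (h + c • h') = ell U δ η m h + c * ell U δ η m h' := by
  unfold ell
  rw [← intervalIntegral.integral_const_mul, ← intervalIntegral.integral_add
    ((hη.continuous_mul_comp_hflow hh U m).intervalIntegrable _ _)
    (((hη.continuous_mul_comp_hflow hh' U m).intervalIntegrable _ _).const_mul c)]
  congr 1
  ext t
  simp only [Pi.add_apply, Pi.smul_apply, smul_eq_mul]
  ring

/-- Integration by parts along the flow. -/
lemma ell_VF {δ : ℝ} {η : ℝ → ℂ} (hη : TestFun δ η) (U : ℝ × ℝ × ℝ) (m : Heis)
    {h : Heis → ℂ} (hh : ContDiff ℝ (⊤ : ℕ∞) h) :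
    ell U δ η m (VF U h) = -ell U δ (deriv η) m h := by
  unfold ell
  rw [intervalIntegral.integral_mul_deriv_eq_deriv_mul
    (u := η) (u' := deriv η) (v := fun t => h (hflow U t m))
    (fun t _ => (hη.1.differentiable (by simp) t).hasDerivAt)
    (fun t _ => hasDerivAt_comp_hflow hh U m t)
    (hη.deriv.1.continuous.intervalIntegrable _ _)
    (((contDiff_VF hh U).continuous.comp (contDiff_hflow U m).continuous).intervalIntegrable _ _),
    hη.eq_zero (t := δ) (by simp), hη.eq_zero (t := -δ) (by simp)]
  simp

namespace NilSetting

variable (S : NilSetting)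

lemma nrm_nonneg (p q : ℕ) (h : Heis → ℂ) : 0 ≤ S.nrm p q h := by
  refine Real.sSup_nonneg ?_
  rintro x ⟨j, -, m, η, -, -, rfl⟩
  exact norm_nonneg _

variable {S} {N : ℤ} {h : Heis → ℂ}

lemma norm_ell_le_nrm (hh : h ∈ S.cn N) {p q j : ℕ} (hj : j ≤ p) (m : Heis) {η : ℝ → ℂ}
    (hη : TestFun S.δ η) (hη1 : CrNorm q η ≤ 1) :
    ‖ell S.Wd S.δ η m ((VF S.Vd)^[j] h)‖ ≤ S.nrm p q h := by
  refine le_csSup ?_ ⟨j, hj, m, η, hη, hη1, rfl⟩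
  choose C hC0 hC using fun i => (CN.iterate_VF hh S.Vd i).1.exists_bound S.hK
  refine ⟨∑ i ∈ Finset.range (p + 1), C i * (2 * S.δ), ?_⟩
  rintro x ⟨i, hi, m, η, hη, hη1, rfl⟩
  refine (norm_ell_le S.hδ hη hη1 S.Wd m (hC i)).trans ?_
  exact Finset.single_le_sum (f := fun i => C i * (2 * S.δ))
    (fun i _ => mul_nonneg (hC0 i) (by linarith [S.hδ])) (Finset.mem_range.2 (by omega))

lemma nrm_VF_le (hh : h ∈ S.cn N) (p q : ℕ) :
    S.nrm p (q + 1) (VF S.Wd h) ≤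
      (2 * Real.pi * S.K * (N.natAbs : ℝ) * p + 1) * S.nrm p q h := by
  have hn := S.nrm_nonneg p q h
  have hpi := Real.pi_pos.le
  refine Real.sSup_le ?_ (by positivity)
  rintro x ⟨j, hj, m, η, hη, hη1, rfl⟩
  have hVj : CN S.K N ((VF S.Vd)^[j] h) := CN.iterate_VF hh S.Vd j
  rw [CN.iterate_VF_comm hh S.frame, ell_add_smul hη S.Wd m (hVj.VF S.Wd).contDiff.continuous
    (CN.iterate_VF hh S.Vd (j - 1)).contDiff.continuous, ell_VF hη S.Wd m hVj.contDiff]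
  have h1 := norm_ell_le_nrm hh hj m hη.deriv ((crNorm_deriv_le q η).trans hη1)
  have h2 := norm_ell_le_nrm hh ((Nat.sub_le j 1).trans hj) m hη ((crNorm_le_succ q η).trans hη1)
  have hc : ‖(j : ℂ) * (2 * Real.pi * Complex.I * N * S.K)‖ ≤
      2 * Real.pi * S.K * (N.natAbs : ℝ) * p := by
    have hjp : (j : ℝ) ≤ p := by exact_mod_cast hj
    have hN : ‖(N : ℂ)‖ = (N.natAbs : ℝ) := by
      rw [Complex.norm_intCast, Nat.cast_natAbs, Int.cast_abs]
    simp only [norm_mul, Complex.norm_natCast, hN, Complex.norm_I, Complex.norm_real,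
      Complex.norm_ofNat, Real.norm_eq_abs, abs_of_nonneg hpi, mul_one]
    calc (j : ℝ) * (2 * Real.pi * N.natAbs * S.K)
        ≤ p * (2 * Real.pi * N.natAbs * S.K) := by gcongr
      _ = _ := by ring
  calc _ ≤ _ := norm_add_le _ _
    _ ≤ S.nrm p q h + 2 * Real.pi * S.K * (N.natAbs : ℝ) * p * S.nrm p q h := by
      rw [norm_neg, norm_mul]
      exact add_le_add h1 (mul_le_mul hc h2 (norm_nonneg _) (by positivity))
    _ = _ := by ring

variable (S N) in
/-- The space `C^∞_N` as a complex vector space. -/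
def cnSubmodule : Submodule ℂ (Heis → ℂ) where
  carrier := S.cn N
  add_mem' := CN.add
  zero_mem' := CN.zero S.K N
  smul_mem' c _ hh := CN.smul hh c

end NilSetting

/-- **Lemma 2.7.** For any `p ∈ ℕ₀`, `q ∈ ℕ` the differentiation operator `W` on
`C^∞_N` satisfies `‖Wh‖_{p,q+1} ≤ (2πK|N|p + 1)‖h‖_{p,q}` and extends to a
continuous linear operator `B^{p,q}_N → B^{p,q+1}_N`. -/
theorem cont_W (S : NilSetting) (N : ℤ) (p q : ℕ) (hq : 1 ≤ q)
    (B : Type) [NormedAddCommGroup B] [NormedSpace ℂ B] (j : (Heis → ℂ) → B)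
    (B' : Type) [NormedAddCommGroup B'] [NormedSpace ℂ B'] (j' : (Heis → ℂ) → B')
    (hB : IsCompletion (S.nrm p q) (S.cn N) j)
    (hB' : IsCompletion (S.nrm p (q + 1)) (S.cn N) j') :
    (∀ h ∈ S.cn N,
      S.nrm p (q + 1) (VF S.Wd h) ≤ (2 * Real.pi * S.K * (N.natAbs : ℝ) * p + 1) * S.nrm p q h) ∧
    ∃ Wb : B →L[ℂ] B', ∀ h ∈ S.cn N, Wb (j h) = j' (VF S.Wd h) := by
  have hbound : ∀ h ∈ S.cn N, S.nrm p (q + 1) (VF S.Wd h) ≤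
      (2 * Real.pi * S.K * (N.natAbs : ℝ) * p + 1) * S.nrm p q h :=
    fun h hh => NilSetting.nrm_VF_le hh p q
  refine ⟨hbound, ?_⟩
  obtain ⟨-, hadd, hsmul, hnorm, hdense⟩ := hB
  obtain ⟨hcomplete, hadd', hsmul', hnorm', -⟩ := hB'
  let e : S.cnSubmodule N →ₗ[ℂ] B :=
    { toFun := fun h => j h
      map_add' := fun h h' => hadd h h.2 h' h'.2
      map_smul' := fun c h => hsmul c h h.2 }
  let f : S.cnSubmodule N →ₗ[ℂ] B' :=
    { toFun := fun h => j' (VF S.Wd h)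
      map_add' := fun h h' => by
        rw [← hadd' _ (CN.VF h.2 S.Wd) _ (CN.VF h'.2 S.Wd),
          ← VF_add (CN.contDiff h.2) (CN.contDiff h'.2)]
        rfl
      map_smul' := fun c h => by
        rw [RingHom.id_apply, ← hsmul' c _ (CN.VF h.2 S.Wd), ← VF_smul (CN.contDiff h.2)]
        rfl }
  have hfe : ∀ h, ‖f h‖ ≤ (2 * Real.pi * S.K * (N.natAbs : ℝ) * p + 1) * ‖e h‖ := fun h => by
    change ‖j' (VF S.Wd h)‖ ≤ _ * ‖j h‖
    rw [hnorm' _ (CN.VF h.2 S.Wd), hnorm _ h.2]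
    exact hbound h h.2
  have he : DenseRange e := by
    refine hdense.mono ?_
    rintro _ ⟨h, hh, rfl⟩
    exact ⟨⟨h, hh⟩, rfl⟩
  exact ⟨f.extendOfNorm e, fun h hh => LinearMap.extendOfNorm_eq he ⟨_, hfe⟩ ⟨h, hh⟩⟩
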